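/- Let Q be a symmetric positive definite k×k real matrix, β > 0, λ > 0, and Z ∈ ℝ^{k×N}. Define W̃ ∈ ℝ^{k×k} by W̃_{i,ℓ} = −q_{i,ℓ}/(q_{i,i}+β) for ℓ ≠ i and W̃_{i,i} = 0, h ∈ ℝ^k by h_i = q_{i,i}/(q_{i,i}+β), and b ∈ ℝ^k by b_i = λ/(q_{i,i}+β). Let U be the unique minimizer over ℝ^{k×N} of (1/2)tr((U−Z)ᵀQ(U−Z)) + λ‖U‖₁ + ι_{[0,+∞)^{k×N}}(U) + (β/2)‖U‖²_F. Then U is a fixed point of the ReLU update: for every i, j, u_{i,j} = max(0, h_i z_{i,j} + Σ_{ℓ=1}^k W̃_{i,ℓ}(u_{ℓ,j} − z_{ℓ,j}) − b_i). Moreover h_i ∈ [0,1] and b_i ≥ 0 for every i. -/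

import Mathlib

open Matrix
open scoped Classical

/-- The elastic-net-like regularizer
`ψ(U) = ‖U‖₁ + ι_{[0,∞)^{k×N}}(U) + (β/(2λ)) ‖U‖_F²`, with values in `(-∞, +∞]`. -/
noncomputable def elasticPsi (k N : ℕ) (lam β : ℝ)
    (U : Matrix (Fin k) (Fin N) ℝ) : EReal :=
  ((∑ i, ∑ j, |U i j| : ℝ) : EReal)
    + (if ∀ i j, 0 ≤ U i j then (0 : EReal) else ⊤)
    + ((β / (2 * lam) * Matrix.trace (Uᵀ * U) : ℝ) : EReal)

/-- The real-valued objective to which the extended-real one reduces on nonnegative matrices. -/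
noncomputable def elasticObjective {k N : ℕ} (Q : Matrix (Fin k) (Fin k) ℝ) (lam β : ℝ)
    (Z V : Matrix (Fin k) (Fin N) ℝ) : ℝ :=
  1 / 2 * Matrix.trace ((V - Z)ᵀ * Q * (V - Z))
    + lam * ((∑ i, ∑ j, V i j) + β / (2 * lam) * Matrix.trace (Vᵀ * V))

theorem elasticPsi_of_nonneg {k N : ℕ} (lam β : ℝ) {V : Matrix (Fin k) (Fin N) ℝ}
    (hV : ∀ i j, 0 ≤ V i j) :
    elasticPsi k N lam β V
      = (((∑ i, ∑ j, V i j) + β / (2 * lam) * Matrix.trace (Vᵀ * V) : ℝ) : EReal) := by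
  have habs : ∀ i j, |V i j| = V i j := fun i j => abs_of_nonneg (hV i j)
  rw [elasticPsi, if_pos hV, add_zero, ← EReal.coe_add]
  simp only [habs]

theorem elasticPsi_of_not_nonneg {k N : ℕ} (lam β : ℝ) {V : Matrix (Fin k) (Fin N) ℝ}
    (hV : ¬ ∀ i j, 0 ≤ V i j) : elasticPsi k N lam β V = ⊤ := by
  rw [elasticPsi, if_neg hV, EReal.coe_add_top, EReal.top_add_coe]

theorem coe_elasticObjective {k N : ℕ} (Q : Matrix (Fin k) (Fin k) ℝ) (lam β : ℝ)
    (Z : Matrix (Fin k) (Fin N) ℝ) {V : Matrix (Fin k) (Fin N) ℝ} (hV : ∀ i j, 0 ≤ V i j) :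
    ((1 / 2 * Matrix.trace ((V - Z)ᵀ * Q * (V - Z)) : ℝ) : EReal)
      + (lam : EReal) * elasticPsi k N lam β V = (elasticObjective Q lam β Z V : EReal) := by
  rw [elasticPsi_of_nonneg lam β hV, ← EReal.coe_mul, ← EReal.coe_add, elasticObjective]

/-- The partial derivative of the objective in the entry `(i, j)`. -/
def elasticGradient {k N : ℕ} (Q : Matrix (Fin k) (Fin k) ℝ) (lam β : ℝ)
    (Z U : Matrix (Fin k) (Fin N) ℝ) (i : Fin k) (j : Fin N) : ℝ :=
  (∑ l, Q i l * (U l j - Z l j)) + lam + β * U i j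

theorem trace_quadratic_add_single {k N : ℕ} {Q : Matrix (Fin k) (Fin k) ℝ} (hQ : Q.IsSymm)
    (D : Matrix (Fin k) (Fin N) ℝ) (i : Fin k) (j : Fin N) (t : ℝ) :
    Matrix.trace ((D + Matrix.single i j t)ᵀ * Q * (D + Matrix.single i j t))
      = Matrix.trace (Dᵀ * Q * D) + 2 * t * (∑ l, Q i l * D l j) + t ^ 2 * Q i i := by
  have hleft : Matrix.trace ((Matrix.single i j t)ᵀ * Q * D) = t * ∑ l, Q i l * D l j := by
    rw [Matrix.transpose_single, Matrix.mul_assoc, Matrix.trace_single_mul, Matrix.mul_apply]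
    simp
  have hright : Matrix.trace (Dᵀ * Q * Matrix.single i j t) = t * ∑ l, Q i l * D l j := by
    rw [← hleft, ← Matrix.trace_transpose]
    simp [Matrix.transpose_mul, hQ.eq, Matrix.mul_assoc]
  have hdiag : Matrix.trace ((Matrix.single i j t)ᵀ * Q * Matrix.single i j t)
      = t ^ 2 * Q i i := by
    rw [Matrix.transpose_single, Matrix.mul_assoc, Matrix.trace_single_mul]
    simp
    ring
  rw [Matrix.transpose_add, Matrix.add_mul, Matrix.add_mul, Matrix.mul_add, Matrix.mul_add,
    Matrix.trace_add, Matrix.trace_add, Matrix.trace_add, hleft, hright, hdiag]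
  ring

theorem elasticObjective_add_single {k N : ℕ} {Q : Matrix (Fin k) (Fin k) ℝ} (hQ : Q.IsSymm)
    {lam : ℝ} (hlam : lam ≠ 0) (β : ℝ) (Z U : Matrix (Fin k) (Fin N) ℝ)
    (i : Fin k) (j : Fin N) (t : ℝ) :
    elasticObjective Q lam β Z (U + Matrix.single i j t)
      = elasticObjective Q lam β Z U + t * elasticGradient Q lam β Z U i j
        + t ^ 2 / 2 * (Q i i + β) := by
  have hsum : ∑ a, ∑ c, (U + Matrix.single i j t) a c = (∑ a, ∑ c, U a c) + t := by
    simp [Finset.sum_add_distrib, Matrix.single_apply, ite_and]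
  have hfrob := trace_quadratic_add_single (Q := 1) Matrix.isSymm_one U i j t
  simp only [Matrix.mul_one, Matrix.one_apply, ite_mul, one_mul, zero_mul, Finset.sum_ite_eq,
    Finset.mem_univ, if_true] at hfrob
  rw [elasticObjective, elasticObjective, elasticGradient, add_sub_right_comm,
    trace_quadratic_add_single hQ, hsum, hfrob]
  simp only [Matrix.sub_apply]
  field_simp
  ring

/-- A nonnegative point at which the quadratic with slope `g` and curvature `c` does not decrease
along feasible displacements is fixed by the projected Newton step. -/
theorem eq_max_of_forall_quadratic_nonneg {u g c : ℝ} (hu : 0 ≤ u) (hc : 0 < c)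
    (hmin : ∀ t, 0 ≤ u + t → 0 ≤ t * g + t ^ 2 / 2 * c) : u = max 0 (u - g / c) := by
  rcases le_total 0 (u - g / c) with hs | hs
  · have hstep := hmin (-(g / c)) (by linarith)
    have hval : -(g / c) * g + (-(g / c)) ^ 2 / 2 * c = -((g / c) ^ 2 * c / 2) := by
      field_simp
      ring
    rw [hval] at hstep
    have hzero : g / c = 0 := by
      by_contra hne
      have : 0 < (g / c) ^ 2 * c := by positivity
      linarith
    rw [max_eq_right hs, hzero, sub_zero]
  · have hstep := hmin (-u) (by linarith)
    have hg : u * c ≤ g := (le_div_iff₀ hc).1 (by linarith)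
    rw [max_eq_left hs]
    by_contra hne
    have hpos : 0 < u := lt_of_le_of_ne hu (Ne.symm hne)
    have : 0 < u ^ 2 * c := by positivity
    nlinarith [mul_le_mul_of_nonneg_left hg hu]

/-- the minimizer `U` of the Q-metric elastic-net problem is a fixed
point of the shifted ReLU update with parameters `W̃`, `h`, `b`; moreover
`h i ∈ [0,1]` and `b i ≥ 0`. -/
theorem stmt_8 (k N : ℕ)
    (Q : Matrix (Fin k) (Fin k) ℝ) (hQsymm : Q.IsSymm) (hQpos : Q.PosDef)
    (β lam : ℝ) (hβ : 0 < β) (hlam : 0 < lam)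
    (Z U : Matrix (Fin k) (Fin N) ℝ)
    (hmin : ∀ V : Matrix (Fin k) (Fin N) ℝ,
      ((1 / 2 * Matrix.trace ((U - Z)ᵀ * Q * (U - Z)) : ℝ) : EReal)
          + (lam : EReal) * elasticPsi k N lam β U
        ≤ ((1 / 2 * Matrix.trace ((V - Z)ᵀ * Q * (V - Z)) : ℝ) : EReal)
          + (lam : EReal) * elasticPsi k N lam β V)
    (W : Matrix (Fin k) (Fin k) ℝ)
    (hW : ∀ i l, W i l = if l = i then 0 else -(Q i l) / (Q i i + β))
    (h b : Fin k → ℝ)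
    (hh : ∀ i, h i = Q i i / (Q i i + β))
    (hb : ∀ i, b i = lam / (Q i i + β)) :
    (∀ i : Fin k, ∀ j : Fin N,
        U i j = max 0 (h i * Z i j + (∑ l, W i l * (U l j - Z l j)) - b i))
      ∧ (∀ i, h i ∈ Set.Icc (0 : ℝ) 1) ∧ (∀ i, 0 ≤ b i) := by
  have hQdiag : ∀ i, 0 < Q i i := fun i => hQpos.diag_pos
  have hc : ∀ i, 0 < Q i i + β := fun i => add_pos (hQdiag i) hβ
  have hU : ∀ i j, 0 ≤ U i j := by
    by_contra hneg
    have hzero := hmin 0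
    rw [coe_elasticObjective Q lam β Z (V := 0) (fun _ _ => le_rfl),
      elasticPsi_of_not_nonneg lam β hneg, EReal.coe_mul_top_of_pos hlam, EReal.coe_add_top,
      top_le_iff] at hzero
    exact EReal.coe_ne_top _ hzero
  refine ⟨fun i j => ?_, fun i => ?_, fun i => ?_⟩
  · have hfix : U i j = max 0 (U i j - elasticGradient Q lam β Z U i j / (Q i i + β)) := by
      refine eq_max_of_forall_quadratic_nonneg (hU i j) (hc i) fun t ht => ?_
      have hV : ∀ a c, 0 ≤ (U + Matrix.single i j t) a c := by
        intro a c
        rw [Matrix.add_apply, Matrix.single_apply]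
        split_ifs with hac
        · rw [← hac.1, ← hac.2]
          exact ht
        · rw [add_zero]
          exact hU a c
      have hle := hmin (U + Matrix.single i j t)
      rw [coe_elasticObjective Q lam β Z hU, coe_elasticObjective Q lam β Z hV,
        EReal.coe_le_coe_iff, elasticObjective_add_single hQsymm hlam.ne'] at hle
      linarith
    have hsum : ∑ l, W i l * (U l j - Z l j)
        = (Q i i * (U i j - Z i j) - ∑ l, Q i l * (U l j - Z l j)) / (Q i i + β) := by
      have hterm : ∀ l, W i l * (U l j - Z l j)
          = (if l = i then Q i i * (U i j - Z i j) / (Q i i + β) else 0)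
            - Q i l * (U l j - Z l j) / (Q i i + β) := by
        intro l
        rw [hW]
        split_ifs with hl
        · rw [hl]
          ring
        · ring
      simp only [hterm, Finset.sum_sub_distrib, Finset.sum_ite_eq', Finset.mem_univ, if_true,
        ← Finset.sum_div, sub_div]
    have harg : h i * Z i j + (∑ l, W i l * (U l j - Z l j)) - b i
        = U i j - elasticGradient Q lam β Z U i j / (Q i i + β) := by
      have hne := (hc i).ne'
      rw [hsum, hh, hb, elasticGradient]
      field_simp
      ring
    rw [harg]
    exact hfix
  · rw [hh]
    exact ⟨div_nonneg (hQdiag i).le (hc i).le, (div_le_one (hc i)).2 (by linarith)⟩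
  · rw [hb]
    exact div_nonneg hlam.le (hc i).le
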